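/- Let ABC be a triangle inscribed in circle k and let M be a point inside k, not on k, with pedal triangle angles α₁, β₁, γ₁ at A₁, B₁, C₁ respectively. If N is the isogonal conjugate of M and both M, N lie inside triangle ABC, then ∠BNC = π − α₁, ∠CNA = π − β₁, ∠ANB = π − γ₁. -/

import Mathlib

open EuclideanGeometry RealInnerProductSpace Real

lemma aux_inner (x y : EuclideanSpace ℝ (Fin 2)) : ⟪x, y⟫ = x 0 * y 0 + x 1 * y 1 := by
  simp [PiLp.inner_apply, Fin.sum_univ_two]
  ring

lemma aux_normsq (x : EuclideanSpace ℝ (Fin 2)) : ‖x‖ ^ 2 = x 0 ^ 2 + x 1 ^ 2 := by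
  rw [← real_inner_self_eq_norm_sq, aux_inner]; ring

lemma aux_cross (a b c : EuclideanSpace ℝ (Fin 2))
    (hnc : ¬ Collinear ℝ ({a, b, c} : Set (EuclideanSpace ℝ (Fin 2)))) :
    (c 0 - b 0) * (a 1 - b 1) - (c 1 - b 1) * (a 0 - b 0) ≠ 0 := by
  intro h
  apply hnc
  by_cases hcb : c = b
  · subst hcb
    simpa using collinear_pair ℝ a c
  have hE : ‖c - b‖ ^ 2 ≠ 0 := by
    have : ‖c - b‖ ≠ 0 := by rwa [norm_ne_zero_iff, sub_ne_zero]
    positivity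
  rw [aux_normsq] at hE
  simp only [PiLp.sub_apply] at hE
  rw [collinear_iff_of_mem (p₀ := b) (by simp)]
  refine ⟨c - b, ?_⟩
  intro p hp
  simp only [Set.mem_insert_iff, Set.mem_singleton_iff] at hp
  rcases hp with rfl | rfl | rfl
  · refine ⟨((c 0 - b 0) * (p 0 - b 0) + (c 1 - b 1) * (p 1 - b 1)) /
      ((c 0 - b 0) ^ 2 + (c 1 - b 1) ^ 2), ?_⟩
    ext i
    fin_cases i
    · simp
      field_simp
      linear_combination (-(c 1 - b 1)) * h
    · simp
      field_simp
      linear_combination (c 0 - b 0) * h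
  · exact ⟨0, by simp⟩
  · exact ⟨1, by simp⟩

lemma aux_scalar (e1 e2 f1 f2 u w u' w' k : ℝ) (hu : 0 < u) (hw' : 0 < w') (hk : 0 < k)
    (hs : e1 * f2 - e2 * f1 ≠ 0)
    (h1 : e1 * (u * f1 + w * e1) + e2 * (u * f2 + w * e2)
      = k * ((u' * f1 + w' * e1) * f1 + (u' * f2 + w' * e2) * f2))
    (h2 : (e1 ^ 2 + e2 ^ 2) * ((u * f1 + w * e1) ^ 2 + (u * f2 + w * e2) ^ 2)
      = k ^ 2 * (((u' * f1 + w' * e1) ^ 2 + (u' * f2 + w' * e2) ^ 2) * (f1 ^ 2 + f2 ^ 2))) :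
    u = k * w' ∧ w * (e1 ^ 2 + e2 ^ 2) = k * u' * (f1 ^ 2 + f2 ^ 2) := by
  have h3 : (e1 * f2 - e2 * f1) ^ 2 * (u ^ 2 - (k * w') ^ 2) = 0 := by
    linear_combination h2 - (e1 * (u * f1 + w * e1) + e2 * (u * f2 + w * e2)
      + k * ((u' * f1 + w' * e1) * f1 + (u' * f2 + w' * e2) * f2)) * h1
  have h4 : u ^ 2 - (k * w') ^ 2 = 0 := by
    rcases mul_eq_zero.1 h3 with h | h
    · exact absurd (pow_eq_zero_iff (two_ne_zero) |>.1 h) hs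
    · exact h
  have h5 : u = k * w' := by
    have : 0 < k * w' := by positivity
    nlinarith
  refine ⟨h5, ?_⟩
  linear_combination h1 - (e1 * f1 + e2 * f2) * h5

lemma aux_vertex (a b c m n a₁ c₁ : EuclideanSpace ℝ (Fin 2))
    (hs : (c 0 - b 0) * (a 1 - b 1) - (c 1 - b 1) * (a 0 - b 0) ≠ 0)
    (hm : ∃ u v w : ℝ, 0 < u ∧ 0 < v ∧ 0 < w ∧ u + v + w = 1 ∧
      m = u • a + v • b + w • c)
    (hn : ∃ u v w : ℝ, 0 < u ∧ 0 < v ∧ 0 < w ∧ u + v + w = 1 ∧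
      n = u • a + v • b + w • c)
    (ha₁ : a₁ ∈ affineSpan ℝ ({b, c} : Set (EuclideanSpace ℝ (Fin 2))))
    (ha₁' : ⟪m - a₁, c - b⟫ = 0)
    (hc₁ : c₁ ∈ affineSpan ℝ ({a, b} : Set (EuclideanSpace ℝ (Fin 2))))
    (hc₁' : ⟪m - c₁, b - a⟫ = 0)
    (hiso2 : ∠ c b m = ∠ n b a) :
    ∃ s : ℝ, 0 < s * ((c 0 - b 0) * (a 1 - b 1) - (c 1 - b 1) * (a 0 - b 0)) ∧
      c₁ 0 - a₁ 0 = - s * (n 1 - b 1) ∧ c₁ 1 - a₁ 1 = s * (n 0 - b 0) := by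
  obtain ⟨u, v, w, hu, hv, hw, huvw, rfl⟩ := hm
  obtain ⟨u', v', w', hu', hv', hw', huvw', rfl⟩ := hn
  obtain ⟨r, rfl⟩ := (mem_affineSpan_pair_iff_exists_lineMap_eq).1 ha₁
  rw [Set.pair_comm] at hc₁
  obtain ⟨q, rfl⟩ := (mem_affineSpan_pair_iff_exists_lineMap_eq).1 hc₁
  obtain rfl : v = 1 - u - w := by linarith
  obtain rfl : v' = 1 - u' - w' := by linarith
  set m := u • a + (1 - u - w) • b + w • c with hm
  set n := u' • a + (1 - u' - w') • b + w' • c with hn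
  have m0 : m 0 - b 0 = u * (a 0 - b 0) + w * (c 0 - b 0) := by simp [hm]; ring
  have m1 : m 1 - b 1 = u * (a 1 - b 1) + w * (c 1 - b 1) := by simp [hm]; ring
  have n0 : n 0 - b 0 = u' * (a 0 - b 0) + w' * (c 0 - b 0) := by simp [hn]; ring
  have n1 : n 1 - b 1 = u' * (a 1 - b 1) + w' * (c 1 - b 1) := by simp [hn]; ring
  have hr : r * ((c 0 - b 0) ^ 2 + (c 1 - b 1) ^ 2)
      = (c 0 - b 0) * (m 0 - b 0) + (c 1 - b 1) * (m 1 - b 1) := by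
    rw [aux_inner] at ha₁'
    simp [AffineMap.lineMap_apply] at ha₁'
    linear_combination -ha₁'
  have hq : q * ((a 0 - b 0) ^ 2 + (a 1 - b 1) ^ 2)
      = (a 0 - b 0) * (m 0 - b 0) + (a 1 - b 1) * (m 1 - b 1) := by
    rw [aux_inner] at hc₁'
    simp [AffineMap.lineMap_apply] at hc₁'
    linear_combination hc₁'
  -- nonvanishing
  have he : c - b ≠ 0 := by
    intro h
    have h0 : c 0 - b 0 = 0 := by simpa using congrArg (fun x : EuclideanSpace ℝ (Fin 2) => x 0) h
    have h1 : c 1 - b 1 = 0 := by simpa using congrArg (fun x : EuclideanSpace ℝ (Fin 2) => x 1) h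
    apply hs; rw [h0, h1]; ring
  have hf : a - b ≠ 0 := by
    intro h
    have h0 : a 0 - b 0 = 0 := by simpa using congrArg (fun x : EuclideanSpace ℝ (Fin 2) => x 0) h
    have h1 : a 1 - b 1 = 0 := by simpa using congrArg (fun x : EuclideanSpace ℝ (Fin 2) => x 1) h
    apply hs; rw [h0, h1]; ring
  have hmb : m - b ≠ 0 := by
    intro h
    have h0 : m 0 - b 0 = 0 := by simpa using congrArg (fun x : EuclideanSpace ℝ (Fin 2) => x 0) h
    have h1 : m 1 - b 1 = 0 := by simpa using congrArg (fun x : EuclideanSpace ℝ (Fin 2) => x 1) h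
    rw [m0] at h0; rw [m1] at h1
    apply hs
    have : u * ((c 0 - b 0) * (a 1 - b 1) - (c 1 - b 1) * (a 0 - b 0)) = 0 := by
      linear_combination (c 0 - b 0) * h1 - (c 1 - b 1) * h0
    exact (mul_eq_zero.1 this).resolve_left hu.ne'
  have hnb : n - b ≠ 0 := by
    intro h
    have h0 : n 0 - b 0 = 0 := by simpa using congrArg (fun x : EuclideanSpace ℝ (Fin 2) => x 0) h
    have h1 : n 1 - b 1 = 0 := by simpa using congrArg (fun x : EuclideanSpace ℝ (Fin 2) => x 1) h
    rw [n0] at h0; rw [n1] at h1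
    apply hs
    have : u' * ((c 0 - b 0) * (a 1 - b 1) - (c 1 - b 1) * (a 0 - b 0)) = 0 := by
      linear_combination (c 0 - b 0) * h1 - (c 1 - b 1) * h0
    exact (mul_eq_zero.1 this).resolve_left hu'.ne'
  have pe := norm_pos_iff.2 he
  have pf := norm_pos_iff.2 hf
  have pm := norm_pos_iff.2 hmb
  have pn := norm_pos_iff.2 hnb
  have hcos := congrArg Real.cos hiso2
  simp only [EuclideanGeometry.angle, InnerProductGeometry.cos_angle, vsub_eq_sub] at hcos
  obtain ⟨k, hk⟩ : ∃ k, k = ‖c - b‖ * ‖m - b‖ / (‖n - b‖ * ‖a - b‖) := ⟨_, rfl⟩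
  have hkpos : 0 < k := by rw [hk]; positivity
  have k1 : k * (‖n - b‖ * ‖a - b‖) = ‖c - b‖ * ‖m - b‖ := by rw [hk]; field_simp
  have h1 : ⟪c - b, m - b⟫ = k * ⟪n - b, a - b⟫ := by
    rw [hk]
    field_simp at hcos ⊢
    linear_combination hcos
  have h2 : ‖c - b‖ ^ 2 * ‖m - b‖ ^ 2 = k ^ 2 * (‖n - b‖ ^ 2 * ‖a - b‖ ^ 2) := by
    rw [← mul_pow, ← k1]; ring
  simp only [aux_normsq, aux_inner, PiLp.sub_apply, m0, m1, n0, n1] at h1 h2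
  have hE : 0 < (c 0 - b 0) ^ 2 + (c 1 - b 1) ^ 2 := by
    have := aux_normsq (c - b); simp only [PiLp.sub_apply] at this; rw [← this]; positivity
  have hF : 0 < (a 0 - b 0) ^ 2 + (a 1 - b 1) ^ 2 := by
    have := aux_normsq (a - b); simp only [PiLp.sub_apply] at this; rw [← this]; positivity
  obtain ⟨g1, g2⟩ := aux_scalar _ _ _ _ u w u' w' k hu hw' hkpos hs h1 h2
  rw [m0, m1] at hr hq
  have x0 : (AffineMap.lineMap b a q : EuclideanSpace ℝ (Fin 2)) 0 -
      (AffineMap.lineMap b c r : EuclideanSpace ℝ (Fin 2)) 0 = q * (a 0 - b 0) - r * (c 0 - b 0) := by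
    simp [AffineMap.lineMap_apply]
  have x1 : (AffineMap.lineMap b a q : EuclideanSpace ℝ (Fin 2)) 1 -
      (AffineMap.lineMap b c r : EuclideanSpace ℝ (Fin 2)) 1 = q * (a 1 - b 1) - r * (c 1 - b 1) := by
    simp [AffineMap.lineMap_apply]
  rw [x0, x1, n0, n1]
  generalize c 0 - b 0 = e1 at *
  generalize c 1 - b 1 = e2 at *
  generalize a 0 - b 0 = f1 at *
  generalize a 1 - b 1 = f2 at *
  have hr' : r * (e1 ^ 2 + e2 ^ 2) = k * ((u' * f1 + w' * e1) * f1 + (u' * f2 + w' * e2) * f2) := by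
    linear_combination hr + h1
  have hq' : q * (e1 ^ 2 + e2 ^ 2) = k * ((u' * f1 + w' * e1) * e1 + (u' * f2 + w' * e2) * e2) := by
    apply mul_left_cancel₀ hF.ne'
    linear_combination (e1 ^ 2 + e2 ^ 2) * hq + (e1 ^ 2 + e2 ^ 2) * (f1 ^ 2 + f2 ^ 2) * g1
      + (e1 * f1 + e2 * f2) * g2
  refine ⟨k / (e1 ^ 2 + e2 ^ 2) * (e1 * f2 - e2 * f1), ?_, ?_, ?_⟩
  · rw [mul_assoc]
    have := mul_self_pos.2 hs
    positivity
  · apply mul_left_cancel₀ hE.ne'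
    field_simp
    linear_combination f1 * hq' - e1 * hr'
  · apply mul_left_cancel₀ hE.ne'
    field_simp
    linear_combination f2 * hq' - e2 * hr'

lemma aux_final (x y p q : EuclideanSpace ℝ (Fin 2)) (s t : ℝ) (hst : 0 < s * t)
    (hq0 : q 0 = - s * x 1) (hq1 : q 1 = s * x 0)
    (hp0 : p 0 = t * y 1) (hp1 : p 1 = - t * y 0) :
    InnerProductGeometry.angle x y = π - InnerProductGeometry.angle p q := by
  have nq : ‖q‖ = |s| * ‖x‖ := by
    rw [← sq_eq_sq₀ (by positivity) (by positivity), mul_pow, sq_abs, aux_normsq, aux_normsq,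
      hq0, hq1]; ring
  have np : ‖p‖ = |t| * ‖y‖ := by
    rw [← sq_eq_sq₀ (by positivity) (by positivity), mul_pow, sq_abs, aux_normsq, aux_normsq,
      hp0, hp1]; ring
  have hi : ⟪p, q⟫ = -((s * t) * ⟪x, y⟫) := by
    rw [aux_inner, aux_inner, hp0, hp1, hq0, hq1]; ring
  have hnn : ‖p‖ * ‖q‖ = (s * t) * (‖x‖ * ‖y‖) := by
    rw [nq, np, ← abs_of_pos hst, abs_mul]; ring
  unfold InnerProductGeometry.angle
  rw [hi, hnn, neg_div, Real.arccos_neg, mul_div_mul_left _ _ hst.ne']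
  ring

lemma aux_main (a b c m n a₁ b₁ c₁ : EuclideanSpace ℝ (Fin 2))
    (hnc : ¬ Collinear ℝ ({a, b, c} : Set (EuclideanSpace ℝ (Fin 2))))
    (hm : ∃ u v w : ℝ, 0 < u ∧ 0 < v ∧ 0 < w ∧ u + v + w = 1 ∧
      m = u • a + v • b + w • c)
    (hn : ∃ u v w : ℝ, 0 < u ∧ 0 < v ∧ 0 < w ∧ u + v + w = 1 ∧
      n = u • a + v • b + w • c)
    (ha₁ : a₁ ∈ affineSpan ℝ ({b, c} : Set (EuclideanSpace ℝ (Fin 2))))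
    (ha₁' : ⟪m - a₁, c - b⟫ = 0)
    (hb₁ : b₁ ∈ affineSpan ℝ ({c, a} : Set (EuclideanSpace ℝ (Fin 2))))
    (hb₁' : ⟪m - b₁, a - c⟫ = 0)
    (hc₁ : c₁ ∈ affineSpan ℝ ({a, b} : Set (EuclideanSpace ℝ (Fin 2))))
    (hc₁' : ⟪m - c₁, b - a⟫ = 0)
    (hiso2 : ∠ c b m = ∠ n b a) (hiso3 : ∠ a c m = ∠ n c b) :
    ∠ b n c = π - ∠ b₁ a₁ c₁ := by
  have hs := aux_cross a b c hnc
  have e : (a 0 - c 0) * (b 1 - c 1) - (a 1 - c 1) * (b 0 - c 0) =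
    (c 0 - b 0) * (a 1 - b 1) - (c 1 - b 1) * (a 0 - b 0) := by ring
  obtain ⟨s, hs1, hs2, hs3⟩ := aux_vertex a b c m n a₁ c₁ hs hm hn ha₁ ha₁' hc₁ hc₁' hiso2
  obtain ⟨t, ht1, ht2, ht3⟩ := aux_vertex b c a m n b₁ a₁ (by rwa [e])
    (by obtain ⟨u, v, w, h1, h2, h3, h4, h5⟩ := hm
        exact ⟨v, w, u, h2, h3, h1, by linarith, by rw [h5]; abel⟩)
    (by obtain ⟨u, v, w, h1, h2, h3, h4, h5⟩ := hn
        exact ⟨v, w, u, h2, h3, h1, by linarith, by rw [h5]; abel⟩)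
    hb₁ hb₁' ha₁ ha₁' hiso3
  rw [e] at ht1
  have hst : 0 < s * t := by
    by_contra h
    have := mul_pos hs1 ht1
    nlinarith [mul_self_pos.2 hs]
  apply aux_final _ _ _ _ (-s) (-t) (by linarith [neg_mul_neg s t])
  · simp; linear_combination hs2
  · simp; linear_combination hs3
  · simp; linear_combination -ht2
  · simp; linear_combination -ht3

theorem stmt_19 (a b c m n a₁ b₁ c₁ : EuclideanSpace ℝ (Fin 2))
    (hnc : ¬ Collinear ℝ ({a, b, c} : Set (EuclideanSpace ℝ (Fin 2))))
    (hm : ∃ u v w : ℝ, 0 < u ∧ 0 < v ∧ 0 < w ∧ u + v + w = 1 ∧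
      m = u • a + v • b + w • c)
    (hn : ∃ u v w : ℝ, 0 < u ∧ 0 < v ∧ 0 < w ∧ u + v + w = 1 ∧
      n = u • a + v • b + w • c)
    (ha₁ : a₁ ∈ affineSpan ℝ ({b, c} : Set (EuclideanSpace ℝ (Fin 2))))
    (ha₁' : ⟪m - a₁, c - b⟫ = 0)
    (hb₁ : b₁ ∈ affineSpan ℝ ({c, a} : Set (EuclideanSpace ℝ (Fin 2))))
    (hb₁' : ⟪m - b₁, a - c⟫ = 0)
    (hc₁ : c₁ ∈ affineSpan ℝ ({a, b} : Set (EuclideanSpace ℝ (Fin 2))))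
    (hc₁' : ⟪m - c₁, b - a⟫ = 0)
    (hnc₁ : ¬ Collinear ℝ ({a₁, b₁, c₁} : Set (EuclideanSpace ℝ (Fin 2))))
    (hiso1 : ∠ b a m = ∠ n a c) (hiso2 : ∠ c b m = ∠ n b a) (hiso3 : ∠ a c m = ∠ n c b) :
    ∠ b n c = π - ∠ b₁ a₁ c₁ ∧ ∠ c n a = π - ∠ a₁ b₁ c₁ ∧ ∠ a n b = π - ∠ a₁ c₁ b₁ := by
  have rot : ∀ {x p q r : EuclideanSpace ℝ (Fin 2)},
      (∃ u v w : ℝ, 0 < u ∧ 0 < v ∧ 0 < w ∧ u + v + w = 1 ∧ x = u • p + v • q + w • r) →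
      ∃ u v w : ℝ, 0 < u ∧ 0 < v ∧ 0 < w ∧ u + v + w = 1 ∧ x = u • q + v • r + w • p := by
    rintro x p q r ⟨u, v, w, h1, h2, h3, h4, h5⟩
    exact ⟨v, w, u, h2, h3, h1, by linarith, by rw [h5]; abel⟩
  have rs : ∀ p q r : EuclideanSpace ℝ (Fin 2),
      ({q, r, p} : Set (EuclideanSpace ℝ (Fin 2))) = {p, q, r} := by
    intro p q r; ext z; simp; tauto
  refine ⟨?_, ?_, ?_⟩
  · exact aux_main a b c m n a₁ b₁ c₁ hnc hm hn ha₁ ha₁' hb₁ hb₁' hc₁ hc₁' hiso2 hiso3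
  · rw [EuclideanGeometry.angle_comm a₁]
    exact aux_main b c a m n b₁ c₁ a₁ (by rwa [rs]) (rot hm) (rot hn) hb₁ hb₁' hc₁ hc₁' ha₁ ha₁'
      hiso3 hiso1
  · exact aux_main c a b m n c₁ a₁ b₁ (by rwa [rs, rs]) (rot (rot hm)) (rot (rot hn))
      hc₁ hc₁' ha₁ ha₁' hb₁ hb₁' hiso1 hiso2
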